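/- Fix c ≥ 1 and let P₁ = ⟨X | R⟩ be the finite presentation with X = {x₁, …, x_c} and R = { [y₁, y₂, …, y_{c+1}] : each y_j ∈ X^{±1} } (a presentation of the free nilpotent group of class c). For 1 ≤ k ≤ c let z_k denote the word [x_k, x_{k+1}, …, x_c], and for n ∈ ℕ and 0 ≤ s ≤ n^c − 1 with n-ary digits s = s₀ + s₁·n + ⋯ + s_{c−1}·n^{c−1} (each s_i ∈ {0,…,n−1}), define the word z̃₁^s := z₁^{s₀} · [x₁^n, z₂^{s₁} · [x₂^n, …, z_{c−1}^{s_{c−2}} · [x_{c−1}^n, z_c^{s_{c−1}}] … ]], and define z̃₁^{n^c} := [x₁^n, x₂^n, …, x_c^n]. Then there exists κ > 0 (depending only on c) such that for all n ∈ ℕ and all 0 ≤ s ≤ n^c − 1, there is a P₁-sequence transforming the word z₁ · z̃₁^s into the word z̃₁^{s+1} with filling length at most κ·n and area at most κ·n^{k+1}, where k is the unique integer with n^k ∣ (s+1) and n^{k+1} ∤ (s+1). -/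

import Mathlib

/-- A word over the alphabet `A`: a list of letters `(a, b)`, where the boolean `b`
records whether the letter is the generator `a` (when `true`) or its formal
inverse `a⁻¹` (when `false`). -/
abbrev Word (A : Type) := List (A × Bool)

/-- The formal inverse of a word. -/
def wordInv {A : Type} (w : Word A) : Word A := (w.map (fun p => (p.1, !p.2))).reverse

/-- `IsCyclicConj v w` : the word `v` is a cyclic conjugate of the word `w`. -/
def IsCyclicConj {A : Type} (v w : Word A) : Prop := ∃ p q, w = p ++ q ∧ v = q ++ p

/-- A free reduction (deleting a subword `a a⁻¹`, `a` a generator or an inverse of a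
generator) or a free expansion (inserting such a subword). -/
def FreeStep {A : Type} (w w' : Word A) : Prop :=
  (∃ (α β : Word A) (x : A × Bool), w = α ++ [x, (x.1, !x.2)] ++ β ∧ w' = α ++ β) ∨
  (∃ (α β : Word A) (x : A × Bool), w = α ++ β ∧ w' = α ++ [x, (x.1, !x.2)] ++ β)

/-- An application of a relator from `R`: replace `w = αuβ` by `w' = αvβ` where
`u v⁻¹` is a cyclic conjugate of an element of `R` or of the inverse of an element
of `R`. -/
def RelStep {A : Type} (R : Set (Word A)) (w w' : Word A) : Prop :=
  ∃ (α u v β : Word A), w = α ++ u ++ β ∧ w' = α ++ v ++ β ∧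
    ∃ r ∈ R, IsCyclicConj (u ++ wordInv v) r ∨ IsCyclicConj (u ++ wordInv v) (wordInv r)

/-- A `P`-sequence for the presentation with relator set `R` : a finite sequence of
words `seq 0, seq 1, …, seq len`, each obtained from the previous one by a free
reduction, a free expansion, or an application of a relator.  The field `isRel`
records which steps are applications of relators. -/
structure PSeq {A : Type} (R : Set (Word A)) where
  len : ℕ
  seq : Fin (len + 1) → Word A
  isRel : Fin len → Bool
  step : ∀ i : Fin len,
    if isRel i then RelStep R (seq i.castSucc) (seq i.succ)
    else FreeStep (seq i.castSucc) (seq i.succ)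

/-- The area of a `P`-sequence: the number of application-of-a-relator moves. -/
def PSeq.area {A : Type} {R : Set (Word A)} (S : PSeq R) : ℕ :=
  (Finset.univ.filter (fun i => S.isRel i = true)).card

/-- The filling length of a `P`-sequence: the maximum of the lengths of its words. -/
def PSeq.fl {A : Type} {R : Set (Word A)} (S : PSeq R) : ℕ :=
  Finset.univ.sup (fun i => (S.seq i).length)

/-- The height of a `P`-sequence: its number of moves. -/
def PSeq.height {A : Type} {R : Set (Word A)} (S : PSeq R) : ℕ := S.len

/-- `S` is a null-`P`-sequence for the word `w`: it starts at `w` and ends at the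
empty word. -/
def IsNullSeq {A : Type} {R : Set (Word A)} (S : PSeq R) (w : Word A) : Prop :=
  S.seq 0 = w ∧ S.seq (Fin.last S.len) = []

/-- The `n`-th power of a word (as a word: `n`-fold concatenation). -/
def wpow {A : Type} (w : Word A) : ℕ → Word A
  | 0 => []
  | n + 1 => w ++ wpow w n

/-- The commutator word `[u,v] = u⁻¹ v⁻¹ u v`. -/
def wcomm {A : Type} (u v : Word A) : Word A := wordInv u ++ wordInv v ++ u ++ v

/-- Iterated (right-nested) commutator word:
`wicomm [a₁, …, a_m] = [a₁, [a₂, …, [a_{m-1}, a_m]…]]`, with `wicomm [a] = a`. -/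
def wicomm {A : Type} : List (Word A) → Word A
  | [] => []
  | [a] => a
  | a :: b :: rest => wcomm a (wicomm (b :: rest))

/-- The relator set `R = { [y₁, …, y_{c+1}] ∣ y_j ∈ X^{±1} }` of the standard
presentation of the free nilpotent group of class `c` on generators `x_0, …, x_{c-1}`
(indexed by `Fin c`). -/
def nilRels (c : ℕ) : Set (Word (Fin c)) :=
  { w | ∃ l : List (Fin c × Bool), l.length = c + 1 ∧ w = wicomm (l.map (fun p => [p])) }

/-- The word `z_k := [x_k, x_{k+1}, …, x_{c-1}]` (0-indexed; so `z_0` is the basic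
length-`c` commutator and `z_{c-1} = x_{c-1}`). -/
def zword (c : ℕ) (k : Fin c) : Word (Fin c) :=
  wicomm ((((List.finRange c).drop k.val)).map (fun i => [(i, true)]))

/-- The `i`-th digit of `s` in base `n`. -/
def ndigit (n s i : ℕ) : ℕ := s / n ^ i % n

/-- The nested compression word
`z_k^{s k} · [x_k^n, z_{k'}^{s k'} · [x_{k'}^n, … ]]` along a list of indices. -/
def wnest (c n : ℕ) (s : ℕ → ℕ) : List (Fin c) → Word (Fin c)
  | [] => []
  | [k] => wpow (zword c k) (s k.val)
  | k :: k' :: rest =>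
      wpow (zword c k) (s k.val) ++ wcomm (wpow [(k, true)] n) (wnest c n s (k' :: rest))

/-- The compression word `z̃₁^s` : for `s < n^c` it is
`z₁^{s₀} [x₁ⁿ, z₂^{s₁} [x₂ⁿ, …, z_{c-1}^{s_{c-2}} [x_{c-1}ⁿ, z_c^{s_{c-1}}]…]]`
(0-indexed here), where `s = s₀ + s₁ n + ⋯ + s_{c-1} n^{c-1}` is the `n`-ary
expansion of `s`; and `z̃₁^{n^c} := [x₁ⁿ, x₂ⁿ, …, x_cⁿ]`. -/
def ztilde (c n s : ℕ) : Word (Fin c) :=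
  if s = n ^ c then wicomm ((List.finRange c).map (fun i => wpow [(i, true)] n))
  else wnest c n (fun i => ndigit n s i) (List.finRange c)

/-- Prepend a move to a `P`-sequence. -/
def PSeq.cons {A : Type} {R : Set (Word A)} (S : PSeq R) (w : Word A) (b : Bool)
    (h : if b then RelStep R w (S.seq 0) else FreeStep w (S.seq 0)) : PSeq R where
  len := S.len + 1
  seq := Fin.cons (α := fun _ => Word A) w S.seq
  isRel := Fin.cons (α := fun _ => Bool) b S.isRel
  step := by
    refine Fin.cases ?_ fun i => ?_
    · simpa using h
    · simpa [← Fin.succ_castSucc] using S.step i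

theorem PSeq.fl_cons_le {A : Type} {R : Set (Word A)} (S : PSeq R) {w : Word A} {b : Bool}
    (h : if b then RelStep R w (S.seq 0) else FreeStep w (S.seq 0)) {L : ℕ}
    (hw : w.length ≤ L) (hS : S.fl ≤ L) : (S.cons w b h).fl ≤ L := by
  refine Finset.sup_le fun i _ => ?_
  refine Fin.cases hw (fun i => ?_) i
  exact (Finset.le_sup (f := fun i => (S.seq i).length) (Finset.mem_univ i)).trans hS

theorem PSeq.area_cons {A : Type} {R : Set (Word A)} (S : PSeq R) {w : Word A} {b : Bool}
    (h : if b then RelStep R w (S.seq 0) else FreeStep w (S.seq 0)) :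
    (S.cons w b h).area = S.area + if b then 1 else 0 := by
  simp only [PSeq.area, Finset.card_filter]
  refine (Fin.sum_univ_succ (n := S.len) _).trans ?_
  rw [add_comm]
  rfl

/-- `Derives R L M w w'`: there is a sequence of moves from `w` to `w'` through words of
length at most `L`, using at most `M` applications of relators. -/
inductive Derives {A : Type} (R : Set (Word A)) (L : ℕ) : ℕ → Word A → Word A → Prop
  | refl (M : ℕ) (w : Word A) (h : w.length ≤ L) : Derives R L M w w
  | free {M : ℕ} {w v u : Word A} (h : w.length ≤ L) (hs : FreeStep w v)
      (hd : Derives R L M v u) : Derives R L M w u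
  | rel {M : ℕ} {w v u : Word A} (h : w.length ≤ L) (hs : RelStep R w v)
      (hd : Derives R L M v u) : Derives R L (M + 1) w u

namespace Derives

variable {A : Type} {R : Set (Word A)} {L M : ℕ} {w v u : Word A}

theorem mono (h : Derives R L M w v) {L' M' : ℕ} (hL : L ≤ L') (hM : M ≤ M') :
    Derives R L' M' w v := by
  induction h generalizing M' with
  | refl M w h => exact .refl _ _ (h.trans hL)
  | free h hs _ ih => exact .free (h.trans hL) hs (ih hM)
  | rel h hs _ ih =>
    obtain ⟨m, rfl⟩ : ∃ m, M' = m + 1 := ⟨M' - 1, by omega⟩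
    exact .rel (h.trans hL) hs (ih (by omega))

theorem trans (h : Derives R L M w v) {N : ℕ} (h' : Derives R L N v u) :
    Derives R L (M + N) w u := by
  induction h with
  | refl M w h => exact h'.mono le_rfl (by omega)
  | free h hs _ ih => exact .free h hs (ih h')
  | rel h hs _ ih => exact (Derives.rel h hs (ih h')).mono le_rfl (by omega)

theorem length_left_le (h : Derives R L M w v) : w.length ≤ L := by
  cases h <;> assumption

theorem of_red (h : FreeGroup.Red w v) (hL : w.length ≤ L) : Derives R L 0 w v := by
  induction h using Relation.ReflTransGen.head_induction_on with
  | refl => exact .refl _ _ hL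
  | head hs _ ih =>
    refine .free hL ?_ (ih ?_)
    · cases hs
      exact Or.inl ⟨_, _, (_, _), by rw [List.append_assoc]; rfl, rfl⟩
    · have := hs.length
      omega

theorem of_red_symm (h : FreeGroup.Red w v) (hL : w.length ≤ L) : Derives R L 0 v w := by
  induction h using Relation.ReflTransGen.head_induction_on with
  | refl => exact .refl _ _ hL
  | @head a b hs _ ih =>
    have hlen := hs.length
    refine (ih (by omega)).trans (M := 0) (N := 0) (.free (by omega) ?_ (.refl _ _ hL))
    cases hs
    exact Or.inr ⟨_, _, (_, _), rfl, by rw [List.append_assoc]; rfl⟩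

/-- Freely equal words are connected by free reductions followed by free expansions. -/
theorem of_mk_eq (h : FreeGroup.mk w = FreeGroup.mk v) (hw : w.length ≤ L)
    (hv : v.length ≤ L) : Derives R L 0 w v := by
  obtain ⟨x, h₁, h₂⟩ := FreeGroup.Red.exact.1 h
  exact (of_red h₁ hw).trans (of_red_symm h₂ hv)

theorem exists_pseq (h : Derives R L M w v) :
    ∃ S : PSeq R, S.seq 0 = w ∧ S.seq (Fin.last S.len) = v ∧ S.fl ≤ L ∧ S.area ≤ M := by
  induction h with
  | refl M w h =>
    exact ⟨⟨0, fun _ => w, Fin.elim0, fun i => i.elim0⟩, rfl, rfl,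
      Finset.sup_le fun _ _ => h, by simp [PSeq.area]⟩
  | free h hs _ ih =>
    obtain ⟨S, rfl, rfl, hfl, ha⟩ := ih
    exact ⟨S.cons _ false (by simpa using hs), rfl, rfl, S.fl_cons_le _ h hfl,
      by simpa [PSeq.area_cons] using ha⟩
  | rel h hs _ ih =>
    obtain ⟨S, rfl, rfl, hfl, ha⟩ := ih
    exact ⟨S.cons _ true (by simpa using hs), rfl, rfl, S.fl_cons_le _ h hfl,
      by simpa [PSeq.area_cons] using ha⟩

end Derives

section Words

variable {A : Type}

@[simp] theorem length_wordInv (w : Word A) : (wordInv w).length = w.length := by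
  simp [wordInv]

@[simp] theorem wordInv_append (u v : Word A) : wordInv (u ++ v) = wordInv v ++ wordInv u := by
  simp [wordInv]

@[simp] theorem wordInv_wordInv (w : Word A) : wordInv (wordInv w) = w :=
  FreeGroup.invRev_invRev

@[simp] theorem length_wpow (w : Word A) (n : ℕ) : (wpow w n).length = n * w.length := by
  induction n with
  | zero => simp [wpow]
  | succ n ih => simp [wpow, ih]; ring

theorem wpow_succ_right (w : Word A) (n : ℕ) : wpow w (n + 1) = wpow w n ++ w := by
  induction n with
  | zero => simp [wpow]
  | succ n ih => rw [wpow, ih, ← List.append_assoc, ← wpow, ih]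

@[simp] theorem length_wcomm (u v : Word A) :
    (wcomm u v).length = 2 * u.length + 2 * v.length := by
  simp [wcomm]; ring

theorem mk_append (u v : Word A) :
    FreeGroup.mk (u ++ v) = FreeGroup.mk u * FreeGroup.mk v := FreeGroup.mul_mk.symm

theorem mk_wordInv (u : Word A) : FreeGroup.mk (wordInv u) = (FreeGroup.mk u)⁻¹ :=
  FreeGroup.inv_mk.symm

theorem mk_wpow (u : Word A) (n : ℕ) : FreeGroup.mk (wpow u n) = FreeGroup.mk u ^ n := by
  induction n with
  | zero => rfl
  | succ n ih => rw [wpow, mk_append, ih, pow_succ']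

theorem mk_wcomm (u v : Word A) : FreeGroup.mk (wcomm u v) =
    (FreeGroup.mk u)⁻¹ * (FreeGroup.mk v)⁻¹ * FreeGroup.mk u * FreeGroup.mk v := by
  simp only [wcomm, mk_append, mk_wordInv]

theorem wicomm_cons (a : Word A) {l : List (Word A)} (hl : l ≠ []) :
    wicomm (a :: l) = wcomm a (wicomm l) := by
  cases l with
  | nil => exact absurd rfl hl
  | cons b l => rfl

/-- The iterated commutator of a list of letters. -/
def lcomm (l : List (A × Bool)) : Word A := wicomm (l.map fun p => [p])

theorem lcomm_cons (p : A × Bool) {l : List (A × Bool)} (hl : l ≠ []) :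
    lcomm (p :: l) = wcomm [p] (lcomm l) :=
  wicomm_cons _ (by simpa using hl)

theorem length_lcomm_le (l : List (A × Bool)) : (lcomm l).length ≤ 4 ^ l.length := by
  induction l with
  | nil => simp [lcomm, wicomm]
  | cons p l ih =>
    rcases eq_or_ne l [] with rfl | hl
    · simp [lcomm, wicomm]
    · have : 1 ≤ 4 ^ l.length := Nat.one_le_pow _ _ (by norm_num)
      rw [lcomm_cons p hl, length_wcomm, List.length_singleton, List.length_cons, pow_succ]
      omega

/-- The commutators of `m + 1` letters. -/
def commRels (A : Type) (m : ℕ) : Set (Word A) := {w | ∃ l, l.length = m + 1 ∧ w = lcomm l}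

/-- `t` is a commutator of `m` letters, or the inverse of one. -/
def IsLettersComm (m : ℕ) (t : Word A) : Prop :=
  ∃ l : List (A × Bool), l.length = m ∧ (t = lcomm l ∨ t = wordInv (lcomm l))

theorem IsLettersComm.inv {m : ℕ} {t : Word A} (h : IsLettersComm m t) :
    IsLettersComm m (wordInv t) := by
  obtain ⟨l, hl, rfl | rfl⟩ := h
  · exact ⟨l, hl, Or.inr rfl⟩
  · exact ⟨l, hl, Or.inl (wordInv_wordInv _)⟩

theorem IsLettersComm.length_le {m : ℕ} {t : Word A} (h : IsLettersComm m t) :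
    t.length ≤ 4 ^ m := by
  obtain ⟨l, rfl, rfl | rfl⟩ := h
  · exact length_lcomm_le l
  · simpa using length_lcomm_le l

theorem relStep_comm_letter {m : ℕ} {t : Word A} (ht : IsLettersComm (m + 1) t)
    (α β : Word A) (y : A × Bool) :
    RelStep (commRels A (m + 1)) (α ++ t ++ [y] ++ β) (α ++ [y] ++ t ++ β) := by
  obtain ⟨l, hl, ht⟩ := ht
  have hl0 : l ≠ [] := by rintro rfl; simp at hl
  refine ⟨α, t ++ [y], [y] ++ t, β, by simp, by simp, lcomm (y :: l), ⟨_, by simp [hl], rfl⟩, ?_⟩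
  rw [lcomm_cons y hl0]
  rcases ht with rfl | rfl
  · exact Or.inr ⟨wordInv (lcomm l) ++ wordInv [y], lcomm l ++ [y],
      by simp only [wcomm, wordInv_append, wordInv_wordInv, List.append_assoc],
      by simp only [wordInv_append, List.append_assoc]⟩
  · exact Or.inl ⟨wordInv [y], wordInv (lcomm l) ++ [y] ++ lcomm l,
      by simp only [wcomm, List.append_assoc],
      by simp only [wordInv_append, wordInv_wordInv, List.append_assoc]⟩

/-- Moving a commutator of `m + 1` letters across a word `v`. -/
theorem Derives.comm_word {m : ℕ} {t : Word A} (ht : IsLettersComm (m + 1) t)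
    (α v β : Word A) {L : ℕ} (hL : (α ++ t ++ v ++ β).length ≤ L) :
    Derives (commRels A (m + 1)) L v.length (α ++ t ++ v ++ β) (α ++ v ++ t ++ β) := by
  induction v generalizing α with
  | nil => simpa using Derives.refl (R := commRels A (m + 1)) 0 _ hL
  | cons y v ih =>
    refine .rel hL (v := α ++ [y] ++ t ++ (v ++ β)) ?_ ?_
    · simpa using relStep_comm_letter ht α (v ++ β) y
    · have := ih (α ++ [y]) (by simp at hL ⊢; omega)
      simpa using this

/-- A derivation `u → u'` over the commutators of `m + 1` letters induces a derivation
`[v, u] → [v, u']` over the commutators of `m + 2` letters. -/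
theorem Derives.lift_wcomm {m L M : ℕ} {u u' : Word A} (v : Word A)
    (h : Derives (commRels A m) L M u u') :
    Derives (commRels A (m + 1)) (2 * v.length + 2 * L + 8 * 4 ^ (m + 1))
      (M * (v.length + 2 * L + 2 * 4 ^ (m + 1))) (wcomm v u) (wcomm v u') := by
  induction h with
  | refl M w h => exact .refl _ _ (by simp; omega)
  | @free M w w' u h hs hd ih =>
    have hw' := hd.length_left_le
    refine ((Derives.of_mk_eq ?_ ?_ ?_).trans ih).mono le_rfl (by omega)
    · have : FreeGroup.mk w = FreeGroup.mk w' := by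
        rcases hs with ⟨α, β, x, rfl, rfl⟩ | ⟨α, β, x, rfl, rfl⟩
        · rw [List.append_assoc]
          exact Quot.sound (FreeGroup.Red.Step.not (L₁ := α) (L₂ := β))
        · rw [List.append_assoc]
          exact (Quot.sound (FreeGroup.Red.Step.not (L₁ := α) (L₂ := β))).symm
      simp only [mk_wcomm, this]
    · simp; omega
    · simp; omega
  | @rel M w w' u h hs hd ih =>
    have hw' := hd.length_left_le
    obtain ⟨α, a, b, β, rfl, rfl, r, ⟨l, hl, rfl⟩, hc⟩ := hs
    obtain ⟨t, ht, p, q, htpq, hab⟩ : ∃ t : Word A, IsLettersComm (m + 1) t ∧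
        ∃ p q, t = p ++ q ∧ a ++ wordInv b = q ++ p := by
      rcases hc with ⟨p, q, h₁, h₂⟩ | ⟨p, q, h₁, h₂⟩
      · exact ⟨_, ⟨l, hl, Or.inl rfl⟩, p, q, h₁, h₂⟩
      · exact ⟨_, ⟨l, hl, Or.inr rfl⟩, p, q, h₁, h₂⟩
    have htl := ht.length_le
    have hpl : p.length ≤ t.length := by simp [htpq]
    have ha : FreeGroup.mk a =
        (FreeGroup.mk p)⁻¹ * FreeGroup.mk t * FreeGroup.mk p * FreeGroup.mk b := by
      have := congrArg FreeGroup.mk hab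
      simp only [mk_append, mk_wordInv] at this
      rw [htpq, mk_append, mul_inv_eq_iff_eq_mul.1 this]
      group
    simp only [List.length_append] at h hw'
    have h₁ : Derives (commRels A (m + 1)) (2 * v.length + 2 * L + 8 * 4 ^ (m + 1)) 0
        (wcomm v (α ++ a ++ β))
        ((wordInv v ++ wordInv (p ++ b ++ β)) ++ wordInv t ++
          (p ++ wordInv α ++ v ++ α ++ wordInv p) ++ (t ++ (p ++ b ++ β))) := by
      refine Derives.of_mk_eq ?_ ?_ ?_
      · simp only [mk_wcomm, mk_append, mk_wordInv, ha]
        group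
      · simp; omega
      · simp; omega
    have h₂ := Derives.comm_word ht.inv (wordInv v ++ wordInv (p ++ b ++ β))
      (p ++ wordInv α ++ v ++ α ++ wordInv p) (t ++ (p ++ b ++ β))
      (L := 2 * v.length + 2 * L + 8 * 4 ^ (m + 1)) (by simp; omega)
    have h₃ : Derives (commRels A (m + 1)) (2 * v.length + 2 * L + 8 * 4 ^ (m + 1)) 0
        ((wordInv v ++ wordInv (p ++ b ++ β)) ++
          (p ++ wordInv α ++ v ++ α ++ wordInv p) ++ wordInv t ++ (t ++ (p ++ b ++ β)))
        (wcomm v (α ++ b ++ β)) := by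
      refine Derives.of_mk_eq ?_ ?_ ?_
      · simp only [mk_wcomm, mk_append, mk_wordInv]
        group
      · simp; omega
      · simp; omega
    refine (((h₁.trans h₂).trans h₃).trans ih).mono le_rfl ?_
    have hv : (p ++ wordInv α ++ v ++ α ++ wordInv p).length ≤
        v.length + 2 * L + 2 * 4 ^ (m + 1) := by
      simp only [List.length_append, length_wordInv]
      omega
    rw [Nat.succ_mul M]
    omega

/-- Distributing the powers of a commutator `z` of `m + 1` letters among the letters of
a power. -/
theorem Derives.distribute {m : ℕ} {z : Word A} (hz : IsLettersComm (m + 1) z)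
    (x α : Word A) (j : ℕ) (β : Word A) {L : ℕ}
    (hL : α.length + β.length + j * (x.length + z.length) ≤ L) :
    Derives (commRels A (m + 1)) L (j * L) (wpow z j ++ α ++ wpow x j ++ β)
      (α ++ wpow (x ++ z) j ++ β) := by
  induction j generalizing β L with
  | zero => exact .refl _ _ (by simpa [wpow] using hL)
  | succ j ih =>
    have hL' : α.length + β.length + (j * (x.length + z.length) + (x.length + z.length)) ≤ L := by
      rw [← Nat.succ_mul]; exact hL
    have hlen : (wpow z j ++ z ++ (α ++ wpow x j ++ x) ++ β).length ≤ L := by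
      simp only [List.length_append, length_wpow]
      linarith
    have h₁ := Derives.comm_word hz (wpow z j) (α ++ wpow x j ++ x) β hlen
    have h₂ := ih (x ++ z ++ β) (L := L) (by simp only [List.length_append]; linarith)
    have hv : (α ++ wpow x j ++ x).length ≤ L := by
      simp only [List.length_append] at hlen ⊢
      omega
    rw [wpow_succ_right, wpow_succ_right, wpow_succ_right]
    simp only [List.append_assoc] at h₁ h₂ ⊢
    refine (h₁.trans h₂).mono le_rfl ?_
    rw [Nat.succ_mul]
    simp only [List.append_assoc] at hv
    omega

/-- Absorbing `n` copies of `z = [x, t]` into `[xⁿ, w]`, giving `[xⁿ, t w]`. -/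
theorem Derives.absorb {m : ℕ} {x t : Word A} (hz : IsLettersComm (m + 1) (wcomm x t))
    (n : ℕ) (w : Word A) {L : ℕ}
    (hL : n * (4 * x.length + 2 * t.length) + 2 * (t ++ w).length ≤ L) :
    Derives (commRels A (m + 1)) L (n * L) (wpow (wcomm x t) n ++ wcomm (wpow x n) w)
      (wcomm (wpow x n) (t ++ w)) := by
  simp only [List.length_append] at hL
  have h₁ := Derives.distribute hz x (wordInv (wpow x n) ++ wordInv w) n w (L := L) (by
    simp; linarith)
  have h₂ : Derives (commRels A (m + 1)) L 0
      (wordInv (wpow x n) ++ wordInv w ++ wpow (x ++ wcomm x t) n ++ w)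
      (wcomm (wpow x n) (t ++ w)) := by
    refine Derives.of_mk_eq ?_ ?_ ?_
    · have hconj : FreeGroup.mk x * ((FreeGroup.mk x)⁻¹ * (FreeGroup.mk t)⁻¹ *
          FreeGroup.mk x * FreeGroup.mk t) =
          (FreeGroup.mk t)⁻¹ * FreeGroup.mk x * ((FreeGroup.mk t)⁻¹)⁻¹ := by group
      simp only [mk_wcomm, mk_append, mk_wordInv, mk_wpow, hconj, conj_pow]
      group
    · simp; linarith
    · simp; nlinarith [Nat.zero_le (n * x.length), Nat.zero_le (n * t.length)]
  simpa [wcomm] using h₁.trans h₂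

/-- The nested compression word of `s` along a list of generators, with the digits
extracted recursively. -/
def nest (n : ℕ) : ℕ → List A → Word A
  | _, [] => []
  | s, [x] => wpow [(x, true)] s
  | s, x :: y :: l => wpow (lcomm ((x :: y :: l).map fun i => (i, true))) (s % n) ++
      wcomm (wpow [(x, true)] n) (nest n (s / n) (y :: l))

theorem exists_length_nest_le (l : List A) :
    ∃ K : ℕ, ∀ n s : ℕ, 1 ≤ n → s ≤ n ^ l.length → (nest n s l).length ≤ K * n := by
  induction l with
  | nil => exact ⟨0, fun n s _ _ => by simp [nest]⟩
  | cons x l ih =>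
    obtain ⟨K, hK⟩ := ih
    cases l with
    | nil => exact ⟨1, fun n s _ hs => by simpa [nest] using hs⟩
    | cons y l =>
      refine ⟨(lcomm ((x :: y :: l).map fun i => (i, true))).length + 2 + 2 * K,
        fun n s hn hs => ?_⟩
      have h₁ := hK n (s / n) hn (Nat.div_le_of_le_mul (by rwa [← pow_succ']))
      have h₂ : s % n ≤ n := (Nat.mod_lt _ hn).le
      simp only [nest, List.length_append, length_wpow, length_wcomm, List.length_singleton]
      nlinarith [Nat.mul_le_mul_right (lcomm ((x :: y :: l).map fun i => (i, true))).length h₂]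

/-- The compression sequence along a nonempty list of generators. -/
theorem exists_derives_nest_succ (l : List A) (hl : l ≠ []) :
    ∃ κ : ℕ, ∀ n s k : ℕ, 2 ≤ n → s + 1 ≤ n ^ l.length → n ^ k ∣ s + 1 →
      ¬ n ^ (k + 1) ∣ s + 1 →
      Derives (commRels A l.length) (κ * n) (κ * n ^ (k + 1))
        (lcomm (l.map fun i => (i, true)) ++ nest n s l) (nest n (s + 1) l) := by
  induction l with
  | nil => exact absurd rfl hl
  | cons x l ih =>
    cases l with
    | nil =>
      refine ⟨1, fun n s k hn hs _ _ => ?_⟩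
      exact .refl _ _ (by simp [nest, lcomm, wicomm] at hs ⊢; omega)
    | cons y l =>
      obtain ⟨κ, hκ⟩ := ih (by simp)
      obtain ⟨K, hK⟩ := exists_length_nest_le (x :: y :: l)
      set t : Word A := lcomm ((y :: l).map fun i => (i, true))
      have hz : lcomm ((x :: y :: l).map fun i => (i, true)) = wcomm [(x, true)] t :=
        lcomm_cons _ (by simp)
      have hzc : IsLettersComm ((y :: l).length + 1) (wcomm [(x, true)] t) :=
        ⟨(x :: y :: l).map fun i => (i, true), by simp, Or.inl hz.symm⟩
      obtain ⟨C, hC⟩ : ∃ C, C = 4 ^ ((y :: l).length + 1) := ⟨_, rfl⟩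
      obtain ⟨T, hT⟩ : ∃ T, T = t.length := ⟨_, rfl⟩
      obtain ⟨B, hB⟩ : ∃ B, B = 4 + 2 * T + 2 * κ + 8 * C + K := ⟨_, rfl⟩
      refine ⟨(κ + 1) * B, fun n s k hn hs hk hk' => ?_⟩
      have hBκ : B * n ≤ (κ + 1) * B * n := by
        nlinarith [Nat.zero_le (κ * (B * n))]
      by_cases hd : n ∣ s + 1
      · obtain ⟨m, hm⟩ := hd
        obtain ⟨k, rfl⟩ : ∃ j, k = j + 1 := by
          rcases k with _ | k
          · exact absurd ⟨m, by simpa using hm⟩ hk'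
          · exact ⟨k, rfl⟩
        obtain ⟨m, rfl⟩ : ∃ j, m = j + 1 := ⟨m - 1, by
          rcases m with _ | m
          · simp at hm
          · simp⟩
        have hs' : s = (n - 1) + n * m := by
          obtain ⟨n, rfl⟩ : ∃ j, n = j + 1 := ⟨n - 1, by omega⟩
          simp only [Nat.add_sub_cancel]
          linarith
        have hmod : s % n = n - 1 := by
          rw [hs', Nat.add_mul_mod_self_left, Nat.mod_eq_of_lt (by omega)]
        have hdiv : s / n = m := by
          rw [hs', Nat.add_mul_div_left _ _ (by omega), Nat.div_eq_of_lt (by omega), zero_add]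
        have hmod' : (s + 1) % n = 0 := by rw [hm, Nat.mul_mod_right]
        have hdiv' : (s + 1) / n = m + 1 := by rw [hm, Nat.mul_div_cancel_left _ (by omega)]
        have hn0 : 0 < n := by omega
        rw [hm, pow_succ'] at hk
        rw [hm, pow_succ'] at hk'
        rw [hm, List.length_cons, pow_succ'] at hs
        have hsub := hκ n m k hn (Nat.le_of_mul_le_mul_left hs hn0)
          (Nat.dvd_of_mul_dvd_mul_left hn0 hk) (fun h => hk' (Nat.mul_dvd_mul_left n h))
        have hlen := hsub.length_left_le
        have h₁ := Derives.absorb hzc n (nest n m (y :: l)) (L := B * n) (by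
          rw [List.length_singleton, ← hT, hB]
          nlinarith [Nat.zero_le (C * n), Nat.zero_le (K * n)])
        have h₂ := (hsub.lift_wcomm (wpow [(x, true)] n)).mono (L' := B * n)
          (M' := κ * n ^ (k + 1) * (B * n)) (by
            rw [← hC, hB, length_wpow, List.length_singleton]
            nlinarith [Nat.zero_le (T * n), Nat.zero_le (K * n), Nat.mul_le_mul_left C hn0]) (by
            refine Nat.mul_le_mul_left _ ?_
            rw [← hC, hB, length_wpow, List.length_singleton]
            nlinarith [Nat.zero_le (T * n), Nat.zero_le (K * n), Nat.mul_le_mul_left C hn0])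
        have h₃ := (h₁.trans h₂).mono hBκ (M' := (κ + 1) * B * n ^ (k + 1 + 1)) (by
          have : n * (B * n) ≤ B * n ^ (k + 1 + 1) := by
            calc n * (B * n) = B * n ^ 2 := by ring
              _ ≤ B * n ^ (k + 1 + 1) :=
                Nat.mul_le_mul_left _ (Nat.pow_le_pow_right hn0 (by omega))
          calc n * (B * n) + κ * n ^ (k + 1) * (B * n)
              ≤ B * n ^ (k + 1 + 1) + κ * n ^ (k + 1) * (B * n) := Nat.add_le_add_right this _
            _ = (κ + 1) * B * n ^ (k + 1 + 1) := by ring)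
        have hpow : wpow (wcomm [(x, true)] t) n =
            wcomm [(x, true)] t ++ wpow (wcomm [(x, true)] t) (n - 1) := by
          obtain ⟨n, rfl⟩ : ∃ j, n = j + 1 := ⟨n - 1, by omega⟩
          rfl
        rw [hpow] at h₃
        simpa only [List.length_cons, nest, hz, hmod, hdiv, hmod', hdiv', wpow, List.nil_append,
          List.append_assoc] using h₃
      · have hdiv : (s + 1) / n = s / n := Nat.succ_div_of_not_dvd hd
        have hmod : (s + 1) % n = s % n + 1 := by
          have h₁ := Nat.div_add_mod s n
          have h₂ := Nat.div_add_mod (s + 1) n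
          rw [hdiv] at h₂
          omega
        have heq : lcomm ((x :: y :: l).map fun i => (i, true)) ++ nest n s (x :: y :: l) =
            nest n (s + 1) (x :: y :: l) := by
          simp only [nest, hmod, hdiv, wpow, List.append_assoc]
        rw [heq]
        refine .refl _ _ ((hK n (s + 1) (by omega) hs).trans (le_trans ?_ hBκ))
        exact Nat.mul_le_mul_right _ (by omega)

theorem nest_pow_length (n : ℕ) (hn : 1 ≤ n) (l : List A) :
    nest n (n ^ l.length) l = wicomm (l.map fun i => wpow [(i, true)] n) := by
  induction l with
  | nil => rfl
  | cons x l ih =>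
    cases l with
    | nil => simp [nest, wicomm]
    | cons y l =>
      rw [List.length_cons, pow_succ', nest, Nat.mul_mod_right, Nat.mul_div_cancel_left _ hn, ih]
      rfl

end Words

theorem nilRels_eq_commRels (c : ℕ) : nilRels c = commRels (Fin c) c := rfl

theorem wnest_drop_finRange (c n s : ℕ) (hs : s < n ^ c) (l : List (Fin c)) (j : ℕ)
    (hl : l = (List.finRange c).drop j) :
    wnest c n (fun i => ndigit n s i) l = nest n (s / n ^ j) l := by
  induction l generalizing j with
  | nil => rfl
  | cons x l ih =>
    have hlen := congrArg List.length hl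
    simp only [List.length_cons, List.length_drop, List.length_finRange] at hlen
    have hj : j < (List.finRange c).length := by simp; omega
    have hl' := hl
    rw [List.drop_eq_getElem_cons hj, List.cons.injEq] at hl'
    obtain ⟨hx, htl⟩ := hl'
    have hxj : x.val = j := by simp [hx]
    have hz : zword c x = lcomm ((x :: l).map fun i => (i, true)) := by
      rw [zword, hxj, ← hl, lcomm, List.map_map]
      rfl
    cases l with
    | nil =>
      have hc : c = j + 1 := by simp at hlen; omega
      have : s / n ^ j < n := by
        refine Nat.div_lt_of_lt_mul ?_
        rwa [← pow_succ, ← hc]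
      simp only [wnest, nest, hz, ndigit, hxj, Nat.mod_eq_of_lt this]
      rfl
    | cons y l =>
      rw [wnest, nest, ih (j + 1) htl, hz, Nat.div_div_eq_div_mul, ← pow_succ]
      simp only [ndigit, hxj]

theorem ztilde_eq_nest (c n s : ℕ) (hn : 1 ≤ n) (hs : s ≤ n ^ c) :
    ztilde c n s = nest n s (List.finRange c) := by
  rw [ztilde]
  split_ifs with h
  · have := nest_pow_length n hn (List.finRange c)
    rw [List.length_finRange] at this
    rw [h, this]
  · simpa using wnest_drop_finRange c n s (by omega) (List.finRange c) 0 (by simp)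

/-- **Proposition (compression, quantitative part).**  Fix `c ≥ 1` and let
`P₁ = ⟨x₁,…,x_c ∣ [y₁,…,y_{c+1}], y_j ∈ X^{±1}⟩` be the standard presentation of the
free nilpotent group of class `c` (generators indexed by `Fin c`).  There is
`κ > 0` (depending only on `c`) such that for all `n ≥ 1` and `0 ≤ s ≤ n^c − 1`,
there is a `P₁`-sequence transforming `z₁·z̃₁^s` into `z̃₁^{s+1}` of filling length
at most `κ·n` and of area at most `κ·n^{k+1}`, where `k` is the integer with
`n^k ∣ (s+1)` and `n^{k+1} ∤ (s+1)`. -/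
theorem compression_sequence
    (c : ℕ) (hc : 1 ≤ c) :
    ∃ κ : ℝ, 0 < κ ∧ ∀ (n s : ℕ), 1 ≤ n → s ≤ n ^ c - 1 →
      ∀ k : ℕ, n ^ k ∣ (s + 1) → ¬ n ^ (k + 1) ∣ (s + 1) →
        ∃ S : PSeq (nilRels c),
          S.seq 0 = zword c ⟨0, hc⟩ ++ ztilde c n s ∧
          S.seq (Fin.last S.len) = ztilde c n (s + 1) ∧
          (S.fl : ℝ) ≤ κ * (n : ℝ) ∧
          (S.area : ℝ) ≤ κ * (n : ℝ) ^ (k + 1) := by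
  obtain ⟨κ, hκ⟩ := exists_derives_nest_succ (List.finRange c) (by
    rw [Ne, List.finRange_eq_nil_iff]; omega)
  refine ⟨κ + 1, by positivity, fun n s hn hs k hk hk' => ?_⟩
  have hn2 : 2 ≤ n := by
    by_contra h
    obtain rfl : n = 1 := by omega
    simp at hk'
  have hpos : 1 ≤ n ^ c := Nat.one_le_pow _ _ hn
  have h := hκ n s k hn2 (by rw [List.length_finRange]; omega) hk hk'
  rw [List.length_finRange] at h
  obtain ⟨S, h0, h1, hfl, ha⟩ := h.exists_pseq
  refine ⟨S, ?_, ?_, ?_, ?_⟩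
  · rw [h0, ztilde_eq_nest c n s hn (by omega), zword, lcomm, List.map_map]
    rfl
  · rw [h1, ztilde_eq_nest c n (s + 1) hn (by omega)]
  · calc (S.fl : ℝ) ≤ ((κ * n : ℕ) : ℝ) := by exact_mod_cast hfl
      _ ≤ (κ + 1) * n := by push_cast; gcongr; linarith
  · calc (S.area : ℝ) ≤ ((κ * n ^ (k + 1) : ℕ) : ℝ) := by exact_mod_cast ha
      _ ≤ (κ + 1) * (n : ℝ) ^ (k + 1) := by push_cast; gcongr; linarith
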